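/- Fix q ∈ (0,1). Let F be the CDF of any probability distribution on [0,∞) with mean at most 1, and let â be the SAA decision based on n IID samples from F. Then for every number of samples n ≥ 1, the expected additive regret satisfies E[L(â)] − L(a*) ≤ (1/√e + 2)·1/((1−q)·√n). -/

import Mathlib

open MeasureTheory Set

noncomputable section

/-- The Newsvendor loss `ℓ(a,Z) = q·max{Z−a,0} + (1−q)·max{a−Z,0}` with critical quantile `q`. -/
def nvLoss (q a z : ℝ) : ℝ := q * max (z - a) 0 + (1 - q) * max (a - z) 0

/-- The expected Newsvendor loss `L(a)` under the demand distribution `μ`. -/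
def expLoss (q : ℝ) (μ : Measure ℝ) (a : ℝ) : ℝ := ∫ z, nvLoss q a z ∂μ

/-- The CDF of the demand distribution `μ`. -/
def cdf' (μ : Measure ℝ) (z : ℝ) : ℝ := (μ (Iic z)).toReal

/-- The optimal decision `a* = inf {a ≥ 0 : F(a) ≥ q}`. -/
def optDec (q : ℝ) (μ : Measure ℝ) : ℝ := sInf {a : ℝ | 0 ≤ a ∧ q ≤ cdf' μ a}

/-- The empirical CDF of the samples `ω : Fin n → ℝ`. -/
def empCdf (n : ℕ) (ω : Fin n → ℝ) (z : ℝ) : ℝ :=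
  (∑ i : Fin n, if ω i ≤ z then (1 : ℝ) else 0) / n

/-- The SAA (sample average approximation) decision `â = inf {a ≥ 0 : F̂(a) ≥ q}`. -/
def saa (q : ℝ) (n : ℕ) (ω : Fin n → ℝ) : ℝ := sInf {a : ℝ | 0 ≤ a ∧ q ≤ empCdf n ω a}

/-- The joint law of `n` iid samples from `μ`. -/
def iid (μ : Measure ℝ) (n : ℕ) : Measure (Fin n → ℝ) := Measure.pi fun _ => μ

/-- A distribution `μ` is `(β,γ,ζ)`-clustered if
`|a − a*| ≤ (1/γ)·|F(a) − q|^{1/(β+1)}` for all `a ∈ [a*−ζ, a*+ζ]`. -/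
def Clustered (q β γ ζ : ℝ) (μ : Measure ℝ) : Prop :=
  ∀ a ∈ Icc (optDec q μ - ζ) (optDec q μ + ζ),
    |a - optDec q μ| ≤ (1 / γ) * |cdf' μ a - q| ^ ((1 : ℝ) / (β + 1))

/-- The decisions `x` and `y` fall on different sides of the quantile `q`. -/
def Misclassified (q x y : ℝ) : Prop := (x < q ∧ q ≤ y) ∨ (q ≤ x ∧ y < q)

lemma ofReal_integral_le_lintegral_ofReal {α : Type*} [MeasurableSpace α] (ν : Measure α)
    (f : α → ℝ) : ENNReal.ofReal (∫ x, f x ∂ν) ≤ ∫⁻ x, ENNReal.ofReal (f x) ∂ν := by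
  by_cases hf : Integrable f ν
  · rw [integral_eq_lintegral_pos_part_sub_lintegral_neg_part hf]
    refine le_trans (ENNReal.ofReal_le_ofReal (sub_le_self _ ENNReal.toReal_nonneg)) ?_
    exact ENNReal.ofReal_toReal_le
  · simp [integral_undef hf]

lemma cdf'_mono (μ : Measure ℝ) [IsProbabilityMeasure μ] : Monotone (cdf' μ) := fun _ _ h =>
  measureReal_mono (Iic_subset_Iic.2 h)

lemma cdf'_nonneg (μ : Measure ℝ) (z : ℝ) : 0 ≤ cdf' μ z := ENNReal.toReal_nonneg

lemma cdf'_le_one (μ : Measure ℝ) [IsProbabilityMeasure μ] (z : ℝ) : cdf' μ z ≤ 1 :=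
  measureReal_le_one

lemma integral_indicator_Iic_eq_cdf' (μ : Measure ℝ) (z : ℝ) :
    ∫ x, (if x ≤ z then (1 : ℝ) else 0) ∂μ = cdf' μ z := by
  have h : (fun x : ℝ => if x ≤ z then (1 : ℝ) else 0) = (Iic z).indicator 1 := by
    ext x; simp [indicator_apply]
  rw [h, integral_indicator_one measurableSet_Iic]
  rfl

lemma nvLoss_sub_nvLoss (q a b x : ℝ) :
    nvLoss q b x - nvLoss q a x = ∫ z in a..b, ((if x ≤ z then (1 : ℝ) else 0) - q) := by
  have hint : ∀ c d : ℝ,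
      IntervalIntegrable (fun z => if x ≤ z then (1 : ℝ) else 0) volume c d := by
    intro c d
    refine Monotone.intervalIntegrable fun z w h => ?_
    split_ifs <;> linarith
  have hbase : ∀ c : ℝ, ∫ z in x..c, (if x ≤ z then (1 : ℝ) else 0) = max (c - x) 0 := by
    intro c
    rcases le_total x c with h | h
    · rw [intervalIntegral.integral_congr (g := fun _ => (1 : ℝ)), max_eq_left (by linarith)]
      · simp
      · intro z hz
        rw [uIcc_of_le h] at hz
        simp [hz.1]
    · rw [intervalIntegral.integral_congr_ae (g := fun _ => (0 : ℝ)), max_eq_right (by linarith)]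
      · simp
      · have : ∀ᵐ z : ℝ, z ≠ x := by simp [ae_iff]
        filter_upwards [this] with z hz hzx
        rw [uIoc_of_ge h] at hzx
        simp [lt_of_le_of_ne hzx.2 hz]
  rw [intervalIntegral.integral_sub (hint a b) (by simp),
    ← intervalIntegral.integral_add_adjacent_intervals (hint a x) (hint x b),
    intervalIntegral.integral_symm x a, hbase, hbase, intervalIntegral.integral_const, nvLoss,
    nvLoss, smul_eq_mul]
  have key : ∀ c : ℝ, max (x - c) 0 = max (c - x) 0 + (x - c) := by
    intro c
    rcases le_total x c with h | h
    · rw [max_eq_right (by linarith), max_eq_left (by linarith)]; ring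
    · rw [max_eq_left (by linarith), max_eq_right (by linarith)]; ring
  rw [key a, key b]
  ring

lemma integrable_nvLoss (q a : ℝ) (μ : Measure ℝ) [IsProbabilityMeasure μ]
    (hmean : Integrable (fun z => z) μ) : Integrable (nvLoss q a) μ := by
  unfold nvLoss
  exact (((hmean.sub (integrable_const a)).pos_part).const_mul q).add
    ((((integrable_const a).sub hmean).pos_part).const_mul (1 - q))

lemma expLoss_nonneg {q : ℝ} (hq : q ∈ Ioo (0 : ℝ) 1) (μ : Measure ℝ) (a : ℝ) :
    0 ≤ expLoss q μ a := by
  refine integral_nonneg fun z => ?_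
  have h1 : 0 ≤ max (z - a) 0 := le_max_right _ _
  have h2 : 0 ≤ max (a - z) 0 := le_max_right _ _
  have h3 : 0 ≤ 1 - q := by linarith [hq.2]
  have h4 := hq.1.le
  unfold nvLoss
  positivity

lemma expLoss_sub_expLoss (q a b : ℝ) (μ : Measure ℝ) [IsProbabilityMeasure μ]
    (hmean : Integrable (fun z => z) μ) :
    expLoss q μ b - expLoss q μ a = ∫ z in a..b, (cdf' μ z - q) := by
  rw [expLoss, expLoss, ← integral_sub (integrable_nvLoss q b μ hmean)
    (integrable_nvLoss q a μ hmean)]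
  simp_rw [nvLoss_sub_nvLoss]
  have hmeas : Measurable fun p : ℝ × ℝ => (if p.2 ≤ p.1 then (1 : ℝ) else 0) - q :=
    (Measurable.ite (measurableSet_le measurable_snd measurable_fst)
      measurable_const measurable_const).sub measurable_const
  rw [← intervalIntegral_integral_swap
    (f := fun z x : ℝ => (if x ≤ z then (1 : ℝ) else 0) - q)]
  · congr 1
    ext z
    rw [integral_sub, integral_indicator_Iic_eq_cdf']
    · simp
    · refine Integrable.of_bound (C := 1) ?_ (ae_of_all _ fun x => ?_)
      · exact (Measurable.ite measurableSet_Iic measurable_const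
          measurable_const).aestronglyMeasurable
      · split_ifs <;> simp
    · simp
  · have : IsFiniteMeasure (volume.restrict (uIoc a b)) := by
      rw [uIoc]; infer_instance
    refine Integrable.of_bound (C := 1 + |q|) hmeas.aestronglyMeasurable (ae_of_all _ ?_)
    rintro ⟨z, x⟩
    refine (norm_sub_le _ _).trans ?_
    simp only [Real.norm_eq_abs]
    gcongr
    split_ifs <;> simp

lemma bddBelow_quantile_set (q : ℝ) (G : ℝ → ℝ) : BddBelow {a : ℝ | 0 ≤ a ∧ q ≤ G a} :=
  ⟨0, fun _ h => h.1⟩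

lemma lt_of_lt_quantile {q z : ℝ} {G : ℝ → ℝ} (hz : 0 ≤ z)
    (h : z < sInf {a : ℝ | 0 ≤ a ∧ q ≤ G a}) : G z < q := by
  by_contra! hle
  exact absurd (csInf_le (bddBelow_quantile_set q G) ⟨hz, hle⟩) (not_le.2 h)

lemma le_of_quantile_lt {q z : ℝ} {G : ℝ → ℝ} (hG : Monotone G)
    (hne : {a : ℝ | 0 ≤ a ∧ q ≤ G a}.Nonempty)
    (h : sInf {a : ℝ | 0 ≤ a ∧ q ≤ G a} < z) : q ≤ G z := by
  obtain ⟨a, ha, haz⟩ := exists_lt_of_csInf_lt hne h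
  exact ha.2.trans (hG haz.le)

lemma quantile_nonneg (q : ℝ) (G : ℝ → ℝ) : 0 ≤ sInf {a : ℝ | 0 ≤ a ∧ q ≤ G a} :=
  Real.sInf_nonneg fun _ h => h.1

lemma quantile_set_cdf'_nonempty {q : ℝ} (hq : q < 1) (μ : Measure ℝ) [IsProbabilityMeasure μ] :
    {a : ℝ | 0 ≤ a ∧ q ≤ cdf' μ a}.Nonempty := by
  have h : Filter.Tendsto (cdf' μ) Filter.atTop (nhds 1) := by
    have h0 := (ENNReal.tendsto_toReal (measure_ne_top μ univ)).comp
      (tendsto_measure_Iic_atTop μ)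
    rw [measure_univ, ENNReal.toReal_one] at h0
    exact h0
  obtain ⟨a, ha, ha0⟩ := ((h.eventually (lt_mem_nhds hq)).and
    (Filter.eventually_ge_atTop 0)).exists
  exact ⟨a, ha0, le_of_lt ha⟩

lemma empCdf_mono (n : ℕ) (ω : Fin n → ℝ) : Monotone (empCdf n ω) := by
  intro z w h
  unfold empCdf
  gcongr with i
  split_ifs <;> linarith

lemma quantile_set_empCdf_nonempty {q : ℝ} (hq : q < 1) {n : ℕ} (hn : 1 ≤ n) (ω : Fin n → ℝ) :
    {a : ℝ | 0 ≤ a ∧ q ≤ empCdf n ω a}.Nonempty := by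
  refine ⟨∑ i, |ω i|, Finset.sum_nonneg fun i _ => abs_nonneg _, ?_⟩
  have h : ∀ i, ω i ≤ ∑ j, |ω j| := fun i => (le_abs_self _).trans
    (Finset.single_le_sum (f := fun j => |ω j|) (fun j _ => abs_nonneg _) (Finset.mem_univ i))
  have hn0 : (n : ℝ) ≠ 0 := by positivity
  simp [empCdf, h, hn0, hq.le]

/-- The pointwise regret is at most the integral of `|G - q|` over the points which the
quantiles of `G` and `H` classify differently. -/
lemma ofReal_intervalIntegral_quantile_le {q : ℝ} {G H : ℝ → ℝ} (hG : Monotone G)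
    (hH : Monotone H) (hGne : {a : ℝ | 0 ≤ a ∧ q ≤ G a}.Nonempty)
    (hHne : {a : ℝ | 0 ≤ a ∧ q ≤ H a}.Nonempty) :
    ENNReal.ofReal (∫ z in (sInf {a : ℝ | 0 ≤ a ∧ q ≤ G a})..(sInf {a : ℝ | 0 ≤ a ∧ q ≤ H a}),
        (G z - q))
      ≤ ∫⁻ z in Ioi 0, {z | Misclassified q (H z) (G z)}.indicator
          (fun z => ENNReal.ofReal |G z - q|) z := by
  have hG0 := quantile_nonneg q G
  have hH0 := quantile_nonneg q H
  have hGlt := fun z (hz : 0 ≤ z) => lt_of_lt_quantile (q := q) (G := G) hz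
  have hHlt := fun z (hz : 0 ≤ z) => lt_of_lt_quantile (q := q) (G := H) hz
  have hGge := fun z => le_of_quantile_lt (z := z) hG hGne
  have hHge := fun z => le_of_quantile_lt (z := z) hH hHne
  set a := sInf {a : ℝ | 0 ≤ a ∧ q ≤ G a}
  set b := sInf {a : ℝ | 0 ≤ a ∧ q ≤ H a}
  rcases le_total a b with h | h
  · rw [intervalIntegral.integral_of_le h, integral_Ioc_eq_integral_Ioo]
    refine (ofReal_integral_le_lintegral_ofReal _ _).trans
      (le_trans (setLIntegral_mono' measurableSet_Ioo fun z hz => ?_)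
        (lintegral_mono_set fun z hz => hG0.trans_lt hz.1))
    rw [indicator_of_mem]
    · exact ENNReal.ofReal_le_ofReal (le_abs_self _)
    · exact Or.inl ⟨hHlt z (hG0.trans hz.1.le) hz.2, hGge z hz.1⟩
  · rw [intervalIntegral.integral_of_ge h, integral_Ioc_eq_integral_Ioo, ← integral_neg]
    refine (ofReal_integral_le_lintegral_ofReal _ _).trans
      (le_trans (setLIntegral_mono' measurableSet_Ioo fun z hz => ?_)
        (lintegral_mono_set fun z hz => hH0.trans_lt hz.1))
    rw [indicator_of_mem]
    · exact ENNReal.ofReal_le_ofReal (neg_le_abs _)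
    · exact Or.inr ⟨hHge z hz.1, hGlt z (hH0.trans hz.1.le) hz.2⟩

lemma measurable_indicator_Iic (z : ℝ) : Measurable fun x : ℝ => if x ≤ z then (1 : ℝ) else 0 :=
  Measurable.ite measurableSet_Iic measurable_const measurable_const

lemma memLp_indicator_Iic (z : ℝ) (μ : Measure ℝ) [IsProbabilityMeasure μ] (p : ENNReal) :
    MemLp (fun x : ℝ => if x ≤ z then (1 : ℝ) else 0) p μ :=
  MemLp.of_bound (measurable_indicator_Iic z).aestronglyMeasurable 1
    (ae_of_all _ fun x => by split_ifs <;> simp)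

lemma measurable_empCdf_uncurry (n : ℕ) :
    Measurable fun p : (Fin n → ℝ) × ℝ => empCdf n p.1 p.2 := by
  unfold empCdf
  refine Measurable.div_const (Finset.measurable_fun_sum _ fun i _ => ?_) _
  exact Measurable.ite (measurableSet_le ((measurable_pi_apply i).comp measurable_fst)
    measurable_snd) measurable_const measurable_const

lemma measurable_empCdf (n : ℕ) (z : ℝ) : Measurable fun ω : Fin n → ℝ => empCdf n ω z :=
  (measurable_empCdf_uncurry n).comp (measurable_id.prodMk measurable_const)

instance (μ : Measure ℝ) [IsProbabilityMeasure μ] (n : ℕ) : IsProbabilityMeasure (iid μ n) := by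
  unfold iid; infer_instance

lemma empCdf_nonneg (n : ℕ) (ω : Fin n → ℝ) (z : ℝ) : 0 ≤ empCdf n ω z :=
  div_nonneg (Finset.sum_nonneg fun i _ => by split_ifs <;> simp) n.cast_nonneg

lemma empCdf_le_one (n : ℕ) (ω : Fin n → ℝ) (z : ℝ) : empCdf n ω z ≤ 1 := by
  refine div_le_one_of_le₀ ?_ n.cast_nonneg
  refine (Finset.sum_le_card_nsmul _ _ 1 fun i _ => ?_).trans (by simp)
  split_ifs <;> simp

lemma memLp_empCdf (μ : Measure ℝ) [IsProbabilityMeasure μ] (n : ℕ) (z : ℝ) (p : ENNReal) :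
    MemLp (fun ω => empCdf n ω z) p (iid μ n) :=
  MemLp.of_bound (measurable_empCdf n z).aestronglyMeasurable 1 (ae_of_all _ fun ω => by
    rw [Real.norm_eq_abs, abs_of_nonneg (empCdf_nonneg n ω z)]
    exact empCdf_le_one n ω z)

lemma integral_empCdf (μ : Measure ℝ) [IsProbabilityMeasure μ] {n : ℕ} (hn : 1 ≤ n) (z : ℝ) :
    ∫ ω, empCdf n ω z ∂(iid μ n) = cdf' μ z := by
  have hn0 : (n : ℝ) ≠ 0 := by positivity
  unfold empCdf iid
  rw [integral_div, integral_finsetSum]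
  · have h : ∀ i : Fin n, ∫ ω : Fin n → ℝ, (if ω i ≤ z then (1 : ℝ) else 0)
        ∂(Measure.pi fun _ => μ) = cdf' μ z := fun i => by
      rw [integral_comp_eval (μ := fun _ : Fin n => μ)
        (f := fun x : ℝ => if x ≤ z then (1 : ℝ) else 0)
        (measurable_indicator_Iic z).aestronglyMeasurable, integral_indicator_Iic_eq_cdf']
    simp [h, hn0]
  · intro i _
    exact integrable_comp_eval (μ := fun _ : Fin n => μ)
      (f := fun x : ℝ => if x ≤ z then (1 : ℝ) else 0)
      ((memLp_indicator_Iic z μ 1).integrable le_rfl)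

lemma variance_empCdf_le (μ : Measure ℝ) [IsProbabilityMeasure μ] {n : ℕ} (hn : 1 ≤ n) (z : ℝ) :
    ProbabilityTheory.variance (fun ω => empCdf n ω z) (iid μ n) ≤ (1 - cdf' μ z) / n := by
  have hn0 : (0 : ℝ) < n := by positivity
  have hvar : ProbabilityTheory.variance (fun x : ℝ => if x ≤ z then (1 : ℝ) else 0) μ
      ≤ 1 - cdf' μ z := by
    have h := ProbabilityTheory.variance_le_sub_mul_sub (μ := μ) (a := 0) (b := 1)
      (X := fun x : ℝ => if x ≤ z then (1 : ℝ) else 0)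
      (ae_of_all _ fun x => by split_ifs <;> simp)
      (measurable_indicator_Iic z).aemeasurable
    rw [integral_indicator_Iic_eq_cdf'] at h
    nlinarith [cdf'_nonneg μ z, cdf'_le_one μ z]
  have hsum := ProbabilityTheory.variance_sum_pi (μ := fun _ : Fin n => μ)
    (X := fun _ (x : ℝ) => if x ≤ z then (1 : ℝ) else 0) (fun _ => memLp_indicator_Iic z μ 2)
  have heq : (fun ω : Fin n → ℝ => empCdf n ω z) = fun ω => (n : ℝ)⁻¹ *
      (∑ i : Fin n, fun ω : Fin n → ℝ => if ω i ≤ z then (1 : ℝ) else 0) ω := by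
    ext ω
    simp [empCdf, div_eq_inv_mul, Finset.sum_apply]
  rw [heq, ProbabilityTheory.variance_const_mul, iid, hsum]
  simp only [Finset.sum_const, Finset.card_univ, Fintype.card_fin, nsmul_eq_mul]
  calc (n : ℝ)⁻¹ ^ 2 * (n * ProbabilityTheory.variance
          (fun x : ℝ => if x ≤ z then (1 : ℝ) else 0) μ)
      ≤ (n : ℝ)⁻¹ ^ 2 * (n * (1 - cdf' μ z)) := by gcongr
    _ = (1 - cdf' μ z) / n := by field_simp

lemma abs_sub_mul_measureReal_misclassified_le {q : ℝ} (hq : q ∈ Ioo (0 : ℝ) 1) (μ : Measure ℝ)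
    [IsProbabilityMeasure μ] {n : ℕ} (hn : 1 ≤ n) (z : ℝ) :
    |cdf' μ z - q| * (iid μ n).real {ω | Misclassified q (empCdf n ω z) (cdf' μ z)}
      ≤ (1 - cdf' μ z) / ((1 - q) * √n) := by
  have hn0 : (0 : ℝ) < n := by positivity
  have hs : 0 < √(n : ℝ) := Real.sqrt_pos.2 hn0
  have hss : √(n : ℝ) * √n = n := Real.mul_self_sqrt hn0.le
  have ht : 0 < 1 - q := by linarith [hq.2]
  have hp : 0 ≤ 1 - cdf' μ z := by linarith [cdf'_le_one μ z]
  set B := {ω | Misclassified q (empCdf n ω z) (cdf' μ z)} with hB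
  set c := |cdf' μ z - q| with hc
  have hP1 : (iid μ n).real B ≤ 1 := measureReal_le_one
  have hP0 : 0 ≤ (iid μ n).real B := measureReal_nonneg
  rcases (abs_nonneg (cdf' μ z - q)).eq_or_lt with h0 | h0
  · rw [hc, ← h0, zero_mul]; positivity
  rcases le_or_gt 1 (c * √n) with hlarge | hsmall
  · have hcheb : (iid μ n).real B ≤ (1 - cdf' μ z) / n / c ^ 2 := by
      have h := ProbabilityTheory.meas_ge_le_variance_div_sq (memLp_empCdf μ n z 2) h0
      rw [integral_empCdf μ hn] at h
      have h2 : (iid μ n) B ≤ ENNReal.ofReal ((1 - cdf' μ z) / n / c ^ 2) := by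
        refine (measure_mono fun ω hω => ?_).trans (h.trans (ENNReal.ofReal_le_ofReal ?_))
        · simp only [mem_ofPred_eq]
          rcases hω with ⟨h1, h2⟩ | ⟨h1, h2⟩
          · rw [abs_of_nonneg (by linarith), abs_of_neg (by linarith)]; linarith
          · rw [abs_of_neg (by linarith), abs_of_nonneg (by linarith)]; linarith
        · gcongr
          exact variance_empCdf_le μ hn z
      exact ENNReal.toReal_le_of_le_ofReal (by positivity) h2
    calc c * (iid μ n).real B ≤ c * ((1 - cdf' μ z) / n / c ^ 2) := by gcongr
      _ = (1 - cdf' μ z) / ((c * √n) * √n) := by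
        rw [mul_assoc, hss]; field_simp
      _ ≤ (1 - cdf' μ z) / ((1 - q) * √n) := by
        gcongr
        linarith [hq.1]
  · have hP : (iid μ n).real B ≤ (1 - cdf' μ z) / (1 - q) := by
      rcases lt_or_ge (cdf' μ z) q with hlt | hge
      · refine hP1.trans ?_
        rw [one_le_div ht]; linarith
      · have hmk := mul_meas_ge_le_integral_of_nonneg (μ := iid μ n)
          (f := fun ω => 1 - empCdf n ω z)
          (ae_of_all _ fun ω => by simpa using empCdf_le_one n ω z)
          ((integrable_const 1).sub ((memLp_empCdf μ n z 1).integrable le_rfl)) (1 - q)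
        rw [integral_sub (integrable_const 1) ((memLp_empCdf μ n z 1).integrable le_rfl),
          integral_empCdf μ hn] at hmk
        rw [le_div_iff₀' ht]
        refine le_trans (mul_le_mul_of_nonneg_left (measureReal_mono fun ω hω => ?_) ht.le)
          (hmk.trans (by simp))
        rcases hω with ⟨h1, h2⟩ | ⟨h1, h2⟩
        · simp only [mem_ofPred_eq]; linarith
        · linarith
    calc c * (iid μ n).real B ≤ (1 / √n) * ((1 - cdf' μ z) / (1 - q)) := by
          gcongr
          rw [le_div_iff₀ hs]; exact hsmall.le
      _ = (1 - cdf' μ z) / ((1 - q) * √n) := by field_simp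

lemma lintegral_ofReal_one_sub_cdf' (μ : Measure ℝ) [IsProbabilityMeasure μ]
    (hsupp : μ (Iio 0) = 0) (hmean : Integrable (fun z => z) μ) :
    ∫⁻ z in Ioi 0, ENNReal.ofReal (1 - cdf' μ z) = ENNReal.ofReal (∫ z, z ∂μ) := by
  have hnn : 0 ≤ᵐ[μ] fun z : ℝ => z := by
    rw [Filter.EventuallyLE, ae_iff]
    convert hsupp using 2
    ext; simp
  rw [ofReal_integral_eq_lintegral_ofReal hmean hnn,
    lintegral_eq_lintegral_meas_lt μ hnn measurable_id.aemeasurable]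
  congr 1
  ext z
  have h : {a : ℝ | z < a} = (Iic z)ᶜ := by ext; simp
  rw [h, ← ofReal_measureReal (μ := μ), probReal_compl_eq_one_sub measurableSet_Iic]
  rfl

lemma lintegral_ofReal_regret_le {q : ℝ} (hq : q ∈ Ioo (0 : ℝ) 1) (μ : Measure ℝ)
    [IsProbabilityMeasure μ] (hsupp : μ (Iio 0) = 0) (hmean : Integrable (fun z => z) μ)
    {n : ℕ} (hn : 1 ≤ n) :
    ∫⁻ ω, ENNReal.ofReal (expLoss q μ (saa q n ω) - expLoss q μ (optDec q μ)) ∂(iid μ n)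
      ≤ ENNReal.ofReal ((∫ z, z ∂μ) / ((1 - q) * √n)) := by
  have hK : 0 ≤ 1 / ((1 - q) * √n) := by
    have : 0 ≤ 1 - q := by linarith [hq.2]
    positivity
  have hF : Measurable fun p : (Fin n → ℝ) × ℝ => cdf' μ p.2 :=
    (cdf'_mono μ).measurable.comp measurable_snd
  have hE := measurable_empCdf_uncurry n
  have hB : MeasurableSet {p : (Fin n → ℝ) × ℝ |
      Misclassified q (empCdf n p.1 p.2) (cdf' μ p.2)} :=
    ((measurableSet_lt hE measurable_const).inter (measurableSet_le measurable_const hF)).union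
      ((measurableSet_le measurable_const hE).inter (measurableSet_lt hF measurable_const))
  have hg : Measurable fun p : (Fin n → ℝ) × ℝ => ENNReal.ofReal |cdf' μ p.2 - q| :=
    ((hF.sub_const q).abs).ennreal_ofReal
  calc ∫⁻ ω, ENNReal.ofReal (expLoss q μ (saa q n ω) - expLoss q μ (optDec q μ)) ∂(iid μ n)
      ≤ ∫⁻ ω, (∫⁻ z in Ioi 0, {z | Misclassified q (empCdf n ω z) (cdf' μ z)}.indicator
          (fun z => ENNReal.ofReal |cdf' μ z - q|) z) ∂(iid μ n) := by
        refine lintegral_mono fun ω => ?_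
        rw [expLoss_sub_expLoss q _ _ μ hmean]
        exact ofReal_intervalIntegral_quantile_le (cdf'_mono μ) (empCdf_mono n ω)
          (quantile_set_cdf'_nonempty hq.2 μ) (quantile_set_empCdf_nonempty hq.2 hn ω)
    _ = ∫⁻ z in Ioi 0, ∫⁻ ω, {ω | Misclassified q (empCdf n ω z) (cdf' μ z)}.indicator
          (fun _ => ENNReal.ofReal |cdf' μ z - q|) ω ∂(iid μ n) :=
        lintegral_lintegral_swap (f := fun ω z =>
          {z | Misclassified q (empCdf n ω z) (cdf' μ z)}.indicator
            (fun z => ENNReal.ofReal |cdf' μ z - q|) z) (hg.indicator hB).aemeasurable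
    _ ≤ ∫⁻ z in Ioi 0, ENNReal.ofReal (1 / ((1 - q) * √n)) * ENNReal.ofReal (1 - cdf' μ z) := by
        refine lintegral_mono fun z => ?_
        have hBz : MeasurableSet {ω | Misclassified q (empCdf n ω z) (cdf' μ z)} :=
          measurable_prodMk_right hB
        rw [lintegral_indicator_const hBz, ← ofReal_measureReal,
          ← ENNReal.ofReal_mul (abs_nonneg _), ← ENNReal.ofReal_mul hK]
        refine ENNReal.ofReal_le_ofReal
          ((abs_sub_mul_measureReal_misclassified_le hq μ hn z).trans_eq ?_)
        ring
    _ = ENNReal.ofReal ((∫ z, z ∂μ) / ((1 - q) * √n)) := by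
        rw [lintegral_const_mul' _ _ ENNReal.ofReal_ne_top,
          lintegral_ofReal_one_sub_cdf' μ hsupp hmean, ← ENNReal.ofReal_mul hK]
        congr 1
        ring

/-- Expected additive regret upper bound for SAA on any distribution with
mean at most 1: for every `n ≥ 1`, `E[L(â)] − L(a*) ≤ (1/√e + 2)·1/((1−q)√n)`. -/
theorem saa_expected_additive_regret_general
    (q : ℝ) (hq : q ∈ Ioo (0:ℝ) 1)
    (μ : Measure ℝ) [IsProbabilityMeasure μ] (hsupp : μ (Iio 0) = 0)
    (hmean : Integrable (fun z => z) μ) (hmean1 : (∫ z, z ∂μ) ≤ 1)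
    (n : ℕ) (hn : 1 ≤ n) :
    (∫ ω, expLoss q μ (saa q n ω) ∂(iid μ n)) - expLoss q μ (optDec q μ)
      ≤ (1/Real.sqrt (Real.exp 1) + 2) * (1/((1-q) * Real.sqrt n)) := by
  have ht : 0 < 1 - q := by linarith [hq.2]
  have hn0 : (0 : ℝ) < n := by positivity
  have hK : 0 < 1 / ((1 - q) * √(n : ℝ)) := by positivity
  have he : 0 ≤ 1 / √(Real.exp 1) := by positivity
  have hrhs : 1 / ((1 - q) * √(n : ℝ)) ≤
      (1 / √(Real.exp 1) + 2) * (1 / ((1 - q) * √(n : ℝ))) :=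
    le_mul_of_one_le_left hK.le (by linarith)
  by_cases hint : Integrable (fun ω => expLoss q μ (saa q n ω)) (iid μ n)
  · refine le_trans ?_ hrhs
    have h := (ofReal_integral_le_lintegral_ofReal (iid μ n) fun ω =>
      expLoss q μ (saa q n ω) - expLoss q μ (optDec q μ)).trans
        (lintegral_ofReal_regret_le hq μ hsupp hmean hn)
    rw [integral_sub hint (integrable_const _), integral_const, probReal_univ, one_smul] at h
    have h' := h.trans (ENNReal.ofReal_le_ofReal
      (div_le_div_of_nonneg_right hmean1 (by positivity : 0 ≤ (1 - q) * √(n : ℝ))))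
    exact (ENNReal.ofReal_le_ofReal_iff hK.le).1 h'
  · rw [integral_undef hint]
    linarith [expLoss_nonneg hq μ (optDec q μ)]
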